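/- arXiv:1708.08143 — 8 statements merged into one kernel-verified Lean document; each statement's English description precedes it below -/
import Mathlib

section
/- Let μ be a probability measure on ℝ that is absolutely continuous with respect to Lebesgue measure and has finite second moment. Let u, v : ℝ → ℝ be Borel measurable functions that are square-integrable with respect to μ and such that the maps x ↦ x + u(x) and x ↦ x + v(x) are each nondecreasing on a Borel set of full μ-measure. Then the squared 2-Wasserstein distance between the pushforward measures (id+u)#μ and (id+v)#μ equals the squared L²(μ)-distance between u and v: ∫₀¹ (F⁻_{(id+u)#μ}(α) − F⁻_{(id+v)#μ}(α))² dα = ∫_ℝ (u(x) − v(x))² dμ(x). -/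
open MeasureTheory Set

/-- Cumulative distribution function of a measure on `ℝ`. -/
noncomputable def cdf (μ : Measure ℝ) (x : ℝ) : ℝ := (μ (Iic x)).toReal

/-- Quantile (generalized inverse cdf) of a measure on `ℝ`. -/
noncomputable def quantile (μ : Measure ℝ) (p : ℝ) : ℝ := sInf {x : ℝ | p ≤ cdf μ x}

/-- Squared 2-Wasserstein distance between measures on `ℝ`, via quantile functions. -/
noncomputable def W2sq (μ ν : Measure ℝ) : ℝ :=
  ∫ α in Ioo (0:ℝ) 1, (quantile μ α - quantile ν α) ^ 2

theorem cdf_eq_probabilityTheory_cdf (μ : Measure ℝ) [IsProbabilityMeasure μ] (x : ℝ) :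
    cdf μ x = ProbabilityTheory.cdf μ x :=
  (ProbabilityTheory.cdf_eq_real μ x).symm

theorem monotone_cdf (μ : Measure ℝ) [IsProbabilityMeasure μ] : Monotone (cdf μ) := by
  intro x y hxy
  simp only [cdf_eq_probabilityTheory_cdf]
  exact ProbabilityTheory.monotone_cdf μ hxy

/-- The quantile function and the cdf form a Galois connection on the open unit interval. -/
theorem quantile_le_iff (μ : Measure ℝ) [IsProbabilityMeasure μ] {p : ℝ}
    (hp : p ∈ Ioo (0 : ℝ) 1) (x : ℝ) : quantile μ p ≤ x ↔ p ≤ cdf μ x := by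
  have hne : {x : ℝ | p ≤ cdf μ x}.Nonempty := by
    obtain ⟨y, hy⟩ :=
      ((ProbabilityTheory.tendsto_cdf_atTop μ).eventually (eventually_gt_nhds hp.2)).exists
    exact ⟨y, by simpa only [mem_ofPred_eq, cdf_eq_probabilityTheory_cdf] using hy.le⟩
  have hbdd : BddBelow {x : ℝ | p ≤ cdf μ x} := by
    obtain ⟨y, hy⟩ :=
      ((ProbabilityTheory.tendsto_cdf_atBot μ).eventually (eventually_lt_nhds hp.1)).exists
    refine ⟨y, fun z hz => ?_⟩
    rw [← cdf_eq_probabilityTheory_cdf] at hy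
    by_contra! h
    exact absurd (hz.trans (monotone_cdf μ h.le)) hy.not_ge
  refine ⟨fun h => ?_, fun h => csInf_le hbdd h⟩
  have hright : Filter.Tendsto (cdf μ) (nhdsWithin x (Ioi x)) (nhds (cdf μ x)) := by
    rw [funext (cdf_eq_probabilityTheory_cdf μ)]
    exact ((ProbabilityTheory.cdf μ).right_continuous x).mono Ioi_subset_Ici_self
  refine ge_of_tendsto hright (eventually_nhdsWithin_of_forall fun y hy => ?_)
  obtain ⟨z, hz, hzy⟩ := exists_lt_of_csInf_lt hne (h.trans_lt hy)
  exact le_trans hz (monotone_cdf μ hzy.le)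

theorem monotoneOn_quantile (μ : Measure ℝ) [IsProbabilityMeasure μ] :
    MonotoneOn (quantile μ) (Ioo 0 1) := fun _ hp _ hq hpq =>
  (quantile_le_iff μ hp _).2 (hpq.trans ((quantile_le_iff μ hq _).1 le_rfl))

theorem aemeasurable_quantile (μ : Measure ℝ) [IsProbabilityMeasure μ] :
    AEMeasurable (quantile μ) (volume.restrict (Ioo 0 1)) :=
  aemeasurable_restrict_of_monotoneOn measurableSet_Ioo (monotoneOn_quantile μ)

/-- The quantile function pushes the uniform distribution on the unit interval to `μ`. -/
theorem map_quantile (μ : Measure ℝ) [IsProbabilityMeasure μ] :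
    (volume.restrict (Ioo (0 : ℝ) 1)).map (quantile μ) = μ := by
  have : IsProbabilityMeasure (volume.restrict (Ioo (0 : ℝ) 1)) := ⟨by simp⟩
  have := Measure.isProbabilityMeasure_map (aemeasurable_quantile μ)
  refine Measure.ext_of_Iic _ _ fun x => ?_
  have hone : cdf μ x ≤ 1 := by
    simpa only [cdf_eq_probabilityTheory_cdf] using ProbabilityTheory.cdf_le_one μ x
  rw [Measure.map_apply_of_aemeasurable (aemeasurable_quantile μ) measurableSet_Iic,
    Measure.restrict_apply' measurableSet_Ioo]
  have hset : quantile μ ⁻¹' Iic x ∩ Ioo 0 1 = Iic (cdf μ x) ∩ Ioo 0 1 := by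
    ext p
    exact and_congr_left fun hp => quantile_le_iff μ hp x
  rw [hset, ← Measure.restrict_apply' measurableSet_Ioo, restrict_Ioo_eq_restrict_Ioc,
    Measure.restrict_apply' measurableSet_Ioc, inter_comm, Ioc_inter_Iic, inf_eq_right.2 hone,
    Real.volume_Ioc, sub_zero, cdf, ENNReal.ofReal_toReal (measure_ne_top _ _)]

theorem cdf_quantile (μ : Measure ℝ) [IsProbabilityMeasure μ] [NullSingletonClass μ] {p : ℝ}
    (hp : p ∈ Ioo (0 : ℝ) 1) : cdf μ (quantile μ p) = p := by
  refine le_antisymm ?_ ((quantile_le_iff μ hp _).1 le_rfl)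
  have hlim : Function.leftLim (ProbabilityTheory.cdf μ) (quantile μ p) = cdf μ (quantile μ p) := by
    have h := (ProbabilityTheory.cdf μ).measure_singleton (quantile μ p)
    rw [ProbabilityTheory.measure_cdf, measure_singleton, eq_comm, ENNReal.ofReal_eq_zero,
      ← cdf_eq_probabilityTheory_cdf] at h
    refine le_antisymm ?_ (sub_nonpos.1 h)
    rw [cdf_eq_probabilityTheory_cdf]
    exact (ProbabilityTheory.monotone_cdf μ).leftLim_le le_rfl
  rw [← hlim]
  refine le_of_tendsto ((ProbabilityTheory.monotone_cdf μ).tendsto_leftLim _)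
    (eventually_nhdsWithin_of_forall fun y hy => ?_)
  rw [← cdf_eq_probabilityTheory_cdf]
  exact (lt_of_not_ge fun h => (mem_Iio.1 hy).not_ge ((quantile_le_iff μ hp y).2 h)).le

theorem measure_setOf_measure_Iic_eq_zero (m : Measure ℝ) :
    m {x | m (Iic x) = 0} = 0 := by
  refine measure_null_of_locally_null _ fun x hx => ?_
  by_cases h : ∃ y, x < y ∧ m (Iic y) = 0
  · obtain ⟨y, hxy, hy⟩ := h
    exact ⟨Iic y, mem_nhdsWithin_of_mem_nhds (Iic_mem_nhds hxy), hy⟩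
  · push Not at h
    refine ⟨Iic x, Filter.mem_of_superset self_mem_nhdsWithin fun y hy => ?_, hx⟩
    exact not_lt.1 fun hxy => h y hxy hy

/-- A map that is monotone on a set of full measure is almost everywhere the composition of the
quantile function of the pushforward measure with the cdf. -/
theorem quantile_map_cdf_ae_eq (μ : Measure ℝ) [IsProbabilityMeasure μ] [NullSingletonClass μ]
    {T : ℝ → ℝ} (hT : Measurable T) {s : Set ℝ} (hs : μ sᶜ = 0) (hmono : MonotoneOn T s) :
    ∀ᵐ x ∂μ, cdf μ x ∈ Ioo (0 : ℝ) 1 → quantile (μ.map T) (cdf μ x) = T x := by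
  have := Measure.isProbabilityMeasure_map (μ := μ) hT.aemeasurable
  have hcdf (c : ℝ) : cdf (μ.map T) c = μ.real (T ⁻¹' Iic c) := by
    rw [cdf, Measure.map_apply hT measurableSet_Iic, Measure.real]
  have hae : ∀ᵐ x ∂μ, x ∈ s := hs
  have hpos (c : ℚ) : ∀ᵐ x ∂μ, (c : ℝ) < T x → μ (Iic x ∩ T ⁻¹' Ioi (c : ℝ)) ≠ 0 := by
    have hmeas : MeasurableSet (T ⁻¹' Ioi (c : ℝ)) := hT measurableSet_Ioi
    have h : ∀ᵐ x ∂μ.restrict (T ⁻¹' Ioi (c : ℝ)), μ.restrict (T ⁻¹' Ioi (c : ℝ)) (Iic x) ≠ 0 := by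
      simpa only [ae_iff, not_not] using measure_setOf_measure_Iic_eq_zero _
    simpa only [Measure.restrict_apply measurableSet_Iic, mem_preimage, mem_Ioi] using
      (ae_restrict_iff' hmeas).1 h
  filter_upwards [hae, ae_all_iff.2 hpos] with x hxs hx hp
  refine le_antisymm ?_ ?_
  · rw [quantile_le_iff _ hp, hcdf]
    refine ENNReal.toReal_mono (measure_ne_top _ _) (measure_mono_ae ?_)
    filter_upwards [hae] with y hys hyx using hmono hys hxs hyx
  · by_contra! h
    obtain ⟨c, hc, hcx⟩ := exists_rat_btwn h
    have hle := (quantile_le_iff _ hp c).1 hc.le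
    rw [hcdf] at hle
    refine hx c hcx ?_
    have hsub : (T ⁻¹' Iic (c : ℝ) : Set ℝ) ≤ᵐ[μ] Iic x := by
      filter_upwards [hae] with y hys hyc
      refine not_lt.1 fun hxy => ?_
      exact (hcx.trans_le (hmono hxs hys hxy.le)).not_ge hyc
    have heq := ae_eq_of_ae_subset_of_measure_ge hsub
      ((ENNReal.toReal_le_toReal (measure_ne_top _ _) (measure_ne_top _ _)).1 hle)
      (hT measurableSet_Iic).nullMeasurableSet (measure_ne_top _ _)
    exact measure_mono_null (t := Iic x \ T ⁻¹' Iic (c : ℝ)) (fun y hy => ⟨hy.1, fun hyc : T y ≤ c => (mem_Ioi.1 hy.2).not_ge hyc⟩)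
      (ae_le_set.1 heq.symm.le)

theorem stmt0 (μ : Measure ℝ) [IsProbabilityMeasure μ]
    (hac : μ ≪ volume) (hmom : Integrable (fun x => x ^ 2) μ)
    (u v : ℝ → ℝ) (hu : Measurable u) (hv : Measurable v)
    (hu2 : Integrable (fun x => (u x) ^ 2) μ) (hv2 : Integrable (fun x => (v x) ^ 2) μ)
    (hum : ∃ s : Set ℝ, MeasurableSet s ∧ μ sᶜ = 0 ∧ MonotoneOn (fun x => x + u x) s)
    (hvm : ∃ s : Set ℝ, MeasurableSet s ∧ μ sᶜ = 0 ∧ MonotoneOn (fun x => x + v x) s) :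
    W2sq (μ.map (fun x => x + u x)) (μ.map (fun x => x + v x))
      = ∫ x, (u x - v x) ^ 2 ∂μ := by
  have : NullSingletonClass μ := ⟨fun x => hac (measure_singleton x)⟩
  obtain ⟨s, -, hs, hsmono⟩ := hum
  obtain ⟨t, -, ht, htmono⟩ := hvm
  have hQ := aemeasurable_quantile μ
  have hU :=
    quantile_map_cdf_ae_eq μ (T := fun x => x + u x) (measurable_id.add hu) hs hsmono
  have hV :=
    quantile_map_cdf_ae_eq μ (T := fun x => x + v x) (measurable_id.add hv) ht htmono
  rw [← map_quantile μ] at hU hV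
  conv_rhs => rw [← map_quantile μ]
  rw [W2sq, integral_map (f := fun x => (u x - v x) ^ 2) hQ
    ((hu.sub hv).pow_const 2).aestronglyMeasurable]
  refine integral_congr_ae ?_
  filter_upwards [ae_of_ae_map hQ hU, ae_of_ae_map hQ hV, ae_restrict_mem measurableSet_Ioo]
    with p hpU hpV hp
  rw [map_quantile, cdf_quantile μ hp] at hpU hpV
  simp only [hpU hp, hpV hp]
  ring
end

section
/- Let μ be a probability measure on ℝ that is absolutely continuous with respect to Lebesgue measure, and let Ω = [a, b] be a closed bounded interval with μ(Ω) = 1. Then the subset V of the Hilbert space L²(μ) consisting of those elements f that admit a representative v : ℝ → ℝ such that the map x ↦ x + v(x) is nondecreasing on a Borel set of full μ-measure and satisfies x + v(x) ∈ [a, b] for μ-almost every x, is a convex and closed subset of L²(μ). -/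
open MeasureTheory Set

/-- The set `V_μ([a,b])` of elements of `L²(μ)` admitting a representative `v` such that
`id + v` is nondecreasing on a Borel set of full `μ`-measure and takes values in `[a,b]`
`μ`-almost everywhere. -/
def Vset (μ : Measure ℝ) (a b : ℝ) : Set (Lp ℝ 2 μ) :=
  {f : Lp ℝ 2 μ | ∃ v : ℝ → ℝ, (⇑f =ᵐ[μ] v) ∧
    (∃ s : Set ℝ, MeasurableSet s ∧ μ sᶜ = 0 ∧ MonotoneOn (fun x => x + v x) s) ∧
    (∀ᵐ x ∂μ, x + v x ∈ Icc a b)}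

open Filter Topology

/-- Membership in `Vset`, phrased with the canonical representative of an `Lp` function. -/
theorem mem_Vset_iff {μ : Measure ℝ} {a b : ℝ} {f : Lp ℝ 2 μ} :
    f ∈ Vset μ a b ↔
      ∃ s ∈ ae μ, MonotoneOn (fun x => x + f x) s ∧ ∀ x ∈ s, x + f x ∈ Icc a b := by
  constructor
  · rintro ⟨v, hfv, ⟨s, -, hs, hmono⟩, hv⟩
    refine ⟨s ∩ {x | f x = v x} ∩ {x | x + v x ∈ Icc a b},
      inter_mem (inter_mem (mem_ae_iff.2 hs) hfv) hv, ?_, ?_⟩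
    · rintro x ⟨⟨hx, hfx⟩, -⟩ y ⟨⟨hy, hfy⟩, -⟩ hxy
      simpa only [mem_ofPred_eq.mp hfx, mem_ofPred_eq.mp hfy] using hmono hx hy hxy
    · rintro x ⟨⟨-, hfx⟩, hx⟩
      rw [mem_ofPred_eq.mp hfx]
      exact hx
  · rintro ⟨s, hs, hmono, hmem⟩
    refine ⟨f, EventuallyEq.rfl, ?_, mem_of_superset hs hmem⟩
    obtain ⟨t, hst, ht, ht0⟩ := exists_measurable_superset_of_null (mem_ae_iff.1 hs)
    exact ⟨tᶜ, ht.compl, by rwa [compl_compl], hmono.mono (compl_subset_comm.1 hst)⟩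

theorem convex_Vset (μ : Measure ℝ) (a b : ℝ) : Convex ℝ (Vset μ a b) := by
  intro f hf g hg p q hp hq hpq
  obtain ⟨s, hs, hfmono, hfmem⟩ := mem_Vset_iff.1 hf
  obtain ⟨t, ht, hgmono, hgmem⟩ := mem_Vset_iff.1 hg
  have hcomb : ∀ᵐ x ∂μ, x + (p • f + q • g : Lp ℝ 2 μ) x = p • (x + f x) + q • (x + g x) := by
    filter_upwards [Lp.coeFn_add (p • f) (q • g), Lp.coeFn_smul p f, Lp.coeFn_smul q g]
      with x hadd hpf hqg
    simp only [hadd, Pi.add_apply, hpf, hqg, Pi.smul_apply, smul_eq_mul]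
    linear_combination (-x) * hpq
  refine mem_Vset_iff.2 ⟨s ∩ t ∩ _, inter_mem (inter_mem hs ht) hcomb, ?_, ?_⟩
  · rintro x ⟨⟨hxs, hxt⟩, hx⟩ y ⟨⟨hys, hyt⟩, hy⟩ hxy
    dsimp only
    rw [mem_ofPred_eq.mp hx, mem_ofPred_eq.mp hy]
    exact add_le_add (smul_le_smul_of_nonneg_left (hfmono hxs hys hxy) hp)
      (smul_le_smul_of_nonneg_left (hgmono hxt hyt hxy) hq)
  · rintro x ⟨⟨hxs, hxt⟩, hx⟩
    rw [mem_ofPred_eq.mp hx]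
    exact convex_Icc a b (hfmem x hxs) (hgmem x hxt) hp hq hpq

theorem isClosed_Vset (μ : Measure ℝ) (a b : ℝ) : IsClosed (Vset μ a b) := by
  refine IsSeqClosed.isClosed fun u f hu huf => ?_
  choose s hs hmono hmem using fun n => mem_Vset_iff.1 (hu n)
  obtain ⟨φ, -, hφ⟩ := (tendstoInMeasure_of_tendsto_Lp huf).exists_seq_tendsto_ae
  have hlim : ∀ x, Tendsto (fun n => u (φ n) x) atTop (𝓝 (f x)) →
      Tendsto (fun n => x + u (φ n) x) atTop (𝓝 (x + f x)) := fun x hx => hx.const_add x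
  refine mem_Vset_iff.2 ⟨(⋂ n, s n) ∩ _, inter_mem (countable_iInter_mem.2 hs) hφ, ?_, ?_⟩
  · rintro x ⟨hxs, hx⟩ y ⟨hys, hy⟩ hxy
    rw [mem_iInter] at hxs hys
    exact le_of_tendsto_of_tendsto' (hlim x hx) (hlim y hy)
      fun n => hmono (φ n) (hxs _) (hys _) hxy
  · rintro x ⟨hxs, hx⟩
    rw [mem_iInter] at hxs
    exact isClosed_Icc.mem_of_tendsto (hlim x hx)
      (Eventually.of_forall fun n => hmem (φ n) x (hxs _))

theorem stmt1 (μ : Measure ℝ) [IsProbabilityMeasure μ] (hac : μ ≪ volume)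
    (a b : ℝ) (hab : a < b) (hΩ : μ (Icc a b) = 1) :
    Convex ℝ (Vset μ a b) ∧ IsClosed (Vset μ a b) := by
  exact ⟨convex_Vset μ a b, isClosed_Vset μ a b⟩
end

section
/- Let μ be a probability measure on ℝ that is absolutely continuous with respect to Lebesgue measure. Then F_μ⁻(F_μ(x)) = x for μ-almost every x ∈ ℝ. -/
open MeasureTheory Set

theorem measure_setOf_Ioc_null (μ : Measure ℝ) (q : ℝ) :
    μ {x | q < x ∧ μ (Ioc q x) = 0} = 0 := by
  refine measure_null_of_locally_null _ fun x hx => ?_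
  by_cases h : ∃ z ∈ {x | q < x ∧ μ (Ioc q x) = 0}, x < z
  · obtain ⟨z, hz, hxz⟩ := h
    exact ⟨Ioc q z, mem_nhdsWithin_of_mem_nhds (Ioc_mem_nhds hx.1 hxz), hz.2⟩
  · push Not at h
    exact ⟨Ioc q x, Filter.mem_of_superset self_mem_nhdsWithin fun z hz => ⟨hz.1, h z hz⟩, hx.2⟩

theorem ae_forall_lt_measure_Ioc_ne_zero (μ : Measure ℝ) :
    ∀ᵐ x ∂μ, ∀ y < x, μ (Ioc y x) ≠ 0 := by
  have h : ∀ᵐ x ∂μ, ∀ q : ℚ, ¬((q : ℝ) < x ∧ μ (Ioc (q : ℝ) x) = 0) :=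
    ae_all_iff.2 fun q => measure_eq_zero_iff_ae_notMem.1 (measure_setOf_Ioc_null μ q)
  filter_upwards [h] with x hx y hyx h0
  obtain ⟨q, hyq, hqx⟩ := exists_rat_btwn hyx
  exact hx q ⟨hqx, measure_mono_null (Ioc_subset_Ioc_left hyq.le) h0⟩

theorem cdf_mono (μ : Measure ℝ) [IsFiniteMeasure μ] : Monotone (cdf μ) :=
  fun _ _ h => measureReal_mono (Iic_subset_Iic.2 h)

theorem cdf_lt_cdf (μ : Measure ℝ) [IsFiniteMeasure μ] {y x : ℝ} (hyx : y < x)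
    (h : μ (Ioc y x) ≠ 0) : cdf μ y < cdf μ x := by
  have hadd : μ.real (Iic y ∪ Ioc y x) = μ.real (Iic y) + μ.real (Ioc y x) :=
    measureReal_union (Iic_disjoint_Ioc le_rfl) measurableSet_Ioc
  rw [Iic_union_Ioc_eq_Iic hyx.le] at hadd
  have hpos : 0 < μ.real (Ioc y x) := ENNReal.toReal_pos h (measure_ne_top _ _)
  change μ.real (Iic y) < μ.real (Iic x)
  linarith

theorem stmt6 (μ : Measure ℝ) [IsProbabilityMeasure μ] (hac : μ ≪ volume) :
    ∀ᵐ x ∂μ, quantile μ (cdf μ x) = x := by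
  filter_upwards [ae_forall_lt_measure_Ioc_ne_zero μ] with x hx
  have hset : {y : ℝ | cdf μ x ≤ cdf μ y} = Ici x := by
    ext y
    refine ⟨fun h => ?_, fun h => cdf_mono μ h⟩
    by_contra hy
    have hyx : y < x := not_le.1 hy
    exact (cdf_lt_cdf μ hyx (hx y hyx)).not_ge h
  rw [quantile, hset, csInf_Ici]
end

section
/- Let ν₁, …, ν_n be probability measures on ℝ with finite second moments, let q̄(α) = (1/n) Σᵢ F_{νᵢ}⁻(α) for α ∈ (0,1), and let ν̄ be the pushforward of Lebesgue measure restricted to (0,1) by q̄. Assume ν̄ is absolutely continuous with respect to Lebesgue measure. Then the log maps ωᵢ(x) = F_{νᵢ}⁻(F_{ν̄}(x)) − x are centered: (1/n) Σᵢ (F_{νᵢ}⁻(F_{ν̄}(x)) − x) = 0 for ν̄-almost every x ∈ ℝ. -/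
open MeasureTheory Set

/-- A monotone function on `(0, 1)` is strictly monotone there if the pushforward of Lebesgue
measure along it has no atoms. -/
theorem strictMonoOn_of_nullSingletonClass_map {q : ℝ → ℝ} (hq : MonotoneOn q (Ioo 0 1))
    [NullSingletonClass ((volume.restrict (Ioo (0 : ℝ) 1)).map q)] : StrictMonoOn q (Ioo 0 1) := by
  intro a ha b hb hab
  refine (hq ha hb hab.le).lt_of_ne fun heq => ?_
  have hsub : Ioo a b ⊆ q ⁻¹' {q a} ∩ Ioo 0 1 := fun c hc => by
    have hc' : c ∈ Ioo (0 : ℝ) 1 := ⟨ha.1.trans hc.1, hc.2.trans hb.2⟩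
    exact ⟨le_antisymm (heq ▸ hq hc' hb hc.2.le) (hq ha hc' hc.1.le), hc'⟩
  have hzero := measure_singleton (μ := (volume.restrict (Ioo (0 : ℝ) 1)).map q) (q a)
  rw [Measure.map_apply_of_aemeasurable (aemeasurable_restrict_of_monotoneOn measurableSet_Ioo hq)
    (measurableSet_singleton _), Measure.restrict_apply' measurableSet_Ioo] at hzero
  have := measure_mono_null hsub hzero
  rw [Real.volume_Ioo, ENNReal.ofReal_eq_zero] at this
  linarith

theorem cdf_map_apply_of_strictMonoOn {q : ℝ → ℝ} (hq : StrictMonoOn q (Ioo 0 1))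
    {a : ℝ} (ha : a ∈ Ioo (0 : ℝ) 1) :
    cdf ((volume.restrict (Ioo (0 : ℝ) 1)).map q) (q a) = a := by
  have hset : q ⁻¹' Iic (q a) ∩ Ioo 0 1 = Ioc 0 a := by
    ext c
    refine ⟨fun hc => ⟨hc.2.1, (hq.le_iff_le hc.2 ha).1 hc.1⟩, fun hc => ?_⟩
    have hc' : c ∈ Ioo (0 : ℝ) 1 := ⟨hc.1, hc.2.trans_lt ha.2⟩
    exact ⟨(hq.le_iff_le hc' ha).2 hc.2, hc'⟩
  rw [cdf, Measure.map_apply_of_aemeasurable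
    (aemeasurable_restrict_of_monotoneOn measurableSet_Ioo hq.monotoneOn) measurableSet_Iic,
    Measure.restrict_apply' measurableSet_Ioo, hset, Real.volume_Ioc, sub_zero,
    ENNReal.toReal_ofReal ha.1.le]

theorem ae_map_mem_image_of_strictMonoOn {q : ℝ → ℝ} (hq : StrictMonoOn q (Ioo 0 1)) :
    ∀ᵐ x ∂(volume.restrict (Ioo (0 : ℝ) 1)).map q, x ∈ q '' Ioo 0 1 := by
  have himage : MeasurableSet (q '' Ioo 0 1) := by
    rw [← range_domRestrict]
    have := measurableSet_Ioo.standardBorel (s := Ioo (0 : ℝ) 1)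
    have hmono := hq.domRestrict
    exact (hmono.monotone.measurable.measurableEmbedding hmono.injective).measurableSet_range
  refine (ae_map_iff (aemeasurable_restrict_of_monotoneOn measurableSet_Ioo hq.monotoneOn)
    himage).2 ?_
  filter_upwards [ae_restrict_mem measurableSet_Ioo] with a ha using mem_image_of_mem q ha


theorem stmt7 (n : ℕ) (hn : 0 < n) (ν : Fin n → Measure ℝ)
    (hprob : ∀ i, IsProbabilityMeasure (ν i))
    (hmom : ∀ i, Integrable (fun x => x ^ 2) (ν i))
    (qbar : ℝ → ℝ) (hq : ∀ α, qbar α = (1 / n : ℝ) * ∑ i, quantile (ν i) α)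
    (νbar : Measure ℝ) (hνbar : νbar = (volume.restrict (Ioo (0:ℝ) 1)).map qbar)
    (hac : νbar ≪ volume) :
    ∀ᵐ x ∂νbar, (1 / n : ℝ) * ∑ i, (quantile (ν i) (cdf νbar x) - x) = 0 := by
  have hmono : MonotoneOn qbar (Ioo 0 1) := fun a ha b hb hab => by
    have := hprob
    rw [hq, hq]
    gcongr with i
    exact monotoneOn_quantile (ν i) ha hb hab
  subst hνbar
  have : NullSingletonClass ((volume.restrict (Ioo (0 : ℝ) 1)).map qbar) :=
    ⟨fun x => hac (measure_singleton x)⟩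
  have hstrict := strictMonoOn_of_nullSingletonClass_map hmono
  filter_upwards [ae_map_mem_image_of_strictMonoOn hstrict]
  rintro _ ⟨a, ha, rfl⟩
  rw [cdf_map_apply_of_strictMonoOn hstrict ha, Finset.sum_sub_distrib, mul_sub, ← hq]
  have hn' : (n : ℝ) ≠ 0 := by exact_mod_cast hn.ne'
  simp [hn']
end

section
/- Let μ be a measure on ℝ that is absolutely continuous with respect to Lebesgue measure with density ρ. Let T : ℝ → ℝ be differentiable and such that |T′(x)| > 0 for Lebesgue-almost every x ∈ ℝ. Then the pushforward measure ν = T#μ is absolutely continuous with respect to Lebesgue measure, with density g given for Lebesgue-almost every y ∈ ℝ by the (possibly infinite) sum over the fiber g(y) = Σ_{x ∈ T⁻¹({y})} ρ(x) / |T′(x)|; equivalently, for every Borel set B ⊆ ℝ, (T#μ)(B) = ∫_B ( Σ_{x ∈ T⁻¹({y})} ρ(x)/|T′(x)| ) dy. -/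
open MeasureTheory Set

open scoped Function in
/-- The set of noncritical points of a differentiable function is a countable disjoint union of
measurable sets on which the function is injective. -/
theorem exists_partition_injOn_of_hasDerivAt {T T' : ℝ → ℝ} (hT : ∀ x, HasDerivAt T (T' x) x) :
    ∃ s : ℕ → Set ℝ, Pairwise (Disjoint on s) ∧ (∀ n, MeasurableSet (s n)) ∧
      (∀ n, InjOn T (s n)) ∧ ⋃ n, s n = {x | T' x ≠ 0} := by
  have hderiv : deriv T = T' := funext fun x => (hT x).deriv
  have hG : MeasurableSet {x | T' x ≠ 0} :=
    hderiv ▸ (measurable_deriv T) (measurableSet_singleton (0 : ℝ)).compl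
  obtain ⟨t, A, hdisj, htm, hcover, happrox, hA⟩ :=
    exists_partition_approximatesLinearOn_of_hasFDerivWithinAt T {x | T' x ≠ 0}
      (fun x => ContinuousLinearMap.toSpanSingleton ℝ (T' x))
      (fun x _ => (hT x).hasFDerivAt.hasFDerivWithinAt)
      (fun A => if A 1 = 0 then 1 else ‖A 1‖₊ / 2) (fun A => by
        split_ifs with h <;> simp [h])
  refine ⟨fun n => {x | T' x ≠ 0} ∩ t n, fun i j hij => ?_, fun n => hG.inter (htm n),
    fun n x hx y hy hxy => ?_, ?_⟩
  · exact (hdisj hij).mono inter_subset_right inter_subset_right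
  · obtain ⟨z, hz, hAz⟩ := hA ⟨x, hx.1⟩ n
    have hz : T' z ≠ 0 := hz
    have h := happrox n x hx y hy
    simp only [hAz, hxy, sub_self, zero_sub, norm_neg,
      ContinuousLinearMap.toSpanSingleton_apply, smul_eq_mul, one_mul, norm_mul, if_neg hz,
      NNReal.coe_div, coe_nnnorm, NNReal.coe_ofNat] at h
    by_contra hne
    have := mul_pos (norm_pos_iff.2 (sub_ne_zero.2 hne)) (norm_pos_iff.2 hz)
    linarith
  · rw [← inter_iUnion]
    exact inter_eq_left.2 hcover

theorem tsum_fiber_indicator_eq_extend {α β : Type*} {T : α → β} {s : Set α} (hinj : InjOn T s)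
    (h : α → ENNReal) (y : β) :
    ∑' x : (T ⁻¹' {y} : Set α), s.indicator h x =
      Function.extend (s.domRestrict T) (s.domRestrict h) 0 y := by
  by_cases hy : ∃ x, s.domRestrict T x = y
  · obtain ⟨⟨x, hx⟩, rfl⟩ := hy
    rw [hinj.injective.extend_apply,
      tsum_eq_single (⟨x, rfl⟩ : (T ⁻¹' {s.domRestrict T ⟨x, hx⟩} : Set α))]
    · exact indicator_of_mem hx h
    · rintro ⟨z, hz⟩ hne
      exact indicator_of_notMem (fun hzs => hne (Subtype.ext (hinj hzs hx hz))) h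
  · rw [Function.extend_apply' _ _ _ hy]
    refine ENNReal.tsum_eq_zero.2 fun z => indicator_of_notMem (fun hz => hy ⟨⟨z, hz⟩, z.2⟩) h

section

variable {T T' : ℝ → ℝ} {h : ℝ → ENNReal}

theorem measurable_tsum_fiber_indicator {s : Set ℝ} (hT : Continuous T) (hs : MeasurableSet s)
    (hinj : InjOn T s) (hh : Measurable h) :
    Measurable fun y => ∑' x : (T ⁻¹' {y} : Set ℝ), s.indicator h x := by
  simp_rw [tsum_fiber_indicator_eq_extend hinj]
  exact (hT.continuousOn.measurableEmbedding hs hinj).measurable_extend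
    (hh.comp measurable_subtype_coe) measurable_const

theorem lintegral_tsum_fiber_indicator {s : Set ℝ} (hT : ∀ x, HasDerivAt T (T' x) x)
    (hs : MeasurableSet s) (hinj : InjOn T s) :
    ∫⁻ y, ∑' x : (T ⁻¹' {y} : Set ℝ), s.indicator h x =
      ∫⁻ x in s, ENNReal.ofReal |T' x| * h x := by
  rw [← setLIntegral_eq_of_support_subset (s := T '' s),
    lintegral_image_eq_lintegral_abs_deriv_mul hs (fun x _ => (hT x).hasDerivWithinAt) hinj]
  · refine setLIntegral_congr_fun hs fun x hx => ?_
    simp only [tsum_fiber_indicator_eq_extend hinj]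
    exact congrArg _ (hinj.injective.extend_apply (s.domRestrict h) 0 ⟨x, hx⟩)
  · refine fun y hy => by_contra fun hys => hy (ENNReal.tsum_eq_zero.2 fun x => ?_)
    exact indicator_of_notMem (fun hx => hys ⟨x, hx, x.2⟩) h

/-- The area formula for differentiable functions of one real variable. -/
theorem lintegral_tsum_fiber_eq_lintegral_abs_deriv_mul (hT : ∀ x, HasDerivAt T (T' x) x)
    (hh : Measurable h) (h0 : ∀ x, T' x = 0 → h x = 0) :
    ∫⁻ y, ∑' x : (T ⁻¹' {y} : Set ℝ), h x = ∫⁻ x, ENNReal.ofReal |T' x| * h x := by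
  obtain ⟨s, hdisj, hs, hinj, hunion⟩ := exists_partition_injOn_of_hasDerivAt hT
  have hcont : Continuous T := continuous_iff_continuousAt.2 fun x => (hT x).continuousAt
  have hsum (x : ℝ) : h x = ∑' n, (s n).indicator h x := by
    by_cases hx : T' x = 0
    · rw [h0 x hx, eq_comm, ENNReal.tsum_eq_zero]
      exact fun n => indicator_apply_eq_zero.2 fun _ => h0 x hx
    · obtain ⟨n, hn⟩ := mem_iUnion.1 (hunion.ge hx)
      rw [tsum_eq_single n, indicator_of_mem hn]
      exact fun m hm => indicator_of_notMem (disjoint_right.1 (hdisj hm) hn) h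
  calc ∫⁻ y, ∑' x : (T ⁻¹' {y} : Set ℝ), h x
      = ∫⁻ y, ∑' n, ∑' x : (T ⁻¹' {y} : Set ℝ), (s n).indicator h x := by
        refine lintegral_congr fun y => ?_
        rw [ENNReal.tsum_comm]
        exact tsum_congr fun x => hsum x
    _ = ∑' n, ∫⁻ x in s n, ENNReal.ofReal |T' x| * h x := by
        rw [lintegral_tsum fun n =>
          (measurable_tsum_fiber_indicator hcont (hs n) (hinj n) hh).aemeasurable]
        exact tsum_congr fun n => lintegral_tsum_fiber_indicator hT (hs n) (hinj n)
    _ = ∫⁻ x in ⋃ n, s n, ENNReal.ofReal |T' x| * h x := (lintegral_iUnion hs hdisj _).symm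
    _ = ∫⁻ x, ENNReal.ofReal |T' x| * h x := by
        refine setLIntegral_eq_of_support_subset ?_
        exact fun x hx => hunion.ge fun hx0 => hx (by simp [hx0])

end

theorem stmt9 (ρ : ℝ → ℝ) (hρpos : ∀ x, 0 ≤ ρ x) (hρmeas : Measurable ρ)
    (μ : Measure ℝ) (hμ : μ = volume.withDensity (fun x => ENNReal.ofReal (ρ x)))
    (T T' : ℝ → ℝ) (hT : ∀ x, HasDerivAt T (T' x) x)
    (hT' : ∀ᵐ x ∂volume, T' x ≠ 0)
    (g : ℝ → ENNReal)
    (hg : ∀ y, g y = ∑' x : (T ⁻¹' {y} : Set ℝ), ENNReal.ofReal (ρ x / |T' x|)) :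
    μ.map T ≪ volume ∧
    ∀ B : Set ℝ, MeasurableSet B → (μ.map T) B = ∫⁻ y in B, g y := by
  have hcont : Continuous T := continuous_iff_continuousAt.2 fun x => (hT x).continuousAt
  have hT'meas : Measurable T' :=
    (funext fun x => (hT x).deriv : deriv T = T') ▸ measurable_deriv T
  have key (B : Set ℝ) (hB : MeasurableSet B) : (μ.map T) B = ∫⁻ y in B, g y := by
    have hpre : MeasurableSet (T ⁻¹' B) := hcont.measurable hB
    let h : ℝ → ENNReal := (T ⁻¹' B).indicator fun x => ENNReal.ofReal (ρ x / |T' x|)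
    have hh : Measurable h := Measurable.indicator (by fun_prop) hpre
    have h0 (x : ℝ) (hx : T' x = 0) : h x = 0 := by simp [h, hx]
    rw [Measure.map_apply hcont.measurable hB, hμ, withDensity_apply _ hpre,
      ← lintegral_indicator hpre, ← lintegral_indicator hB]
    calc ∫⁻ x, (T ⁻¹' B).indicator (fun x => ENNReal.ofReal (ρ x)) x
        = ∫⁻ x, ENNReal.ofReal |T' x| * h x := by
          refine lintegral_congr_ae (hT'.mono fun x hx => ?_)
          by_cases hxB : x ∈ T ⁻¹' B
          · simp only [h, indicator_of_mem hxB]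
            rw [← ENNReal.ofReal_mul (abs_nonneg _), mul_div_cancel₀ _ (abs_ne_zero.2 hx)]
          · simp only [h, indicator_of_notMem hxB, mul_zero]
      _ = ∫⁻ y, ∑' x : (T ⁻¹' {y} : Set ℝ), h x :=
          (lintegral_tsum_fiber_eq_lintegral_abs_deriv_mul hT hh h0).symm
      _ = ∫⁻ y, B.indicator g y := by
          refine lintegral_congr fun y => ?_
          by_cases hy : y ∈ B
          · rw [indicator_of_mem hy, hg]
            refine tsum_congr fun x => indicator_of_mem ?_ _
            rwa [mem_preimage, x.2]
          · rw [indicator_of_notMem hy, ENNReal.tsum_eq_zero]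
            refine fun x => indicator_of_notMem ?_ _
            rwa [mem_preimage, x.2]
  refine ⟨Measure.AbsolutelyContinuous.mk fun B hB hB0 => ?_, key⟩
  rw [key B hB, setLIntegral_measure_zero B g hB0]
end

section
/- Let H be a real inner product space, let V ⊆ H be a convex set with 0 ∈ V, and let ω₁, …, ω_n ∈ H. Then the following two infima are equal: (a) the infimum over u ∈ H of (1/n) Σᵢ inf{ ‖ωᵢ − β u‖² : β ∈ ℝ with β u ∈ V }, and (b) the infimum over pairs (t₀, v) with t₀ ∈ [−1, 1], v ∈ H, (t₀ − 1)v ∈ V and (t₀ + 1)v ∈ V, of (1/n) Σᵢ inf{ ‖ωᵢ − (t₀ + t) v‖² : t ∈ [−1, 1] }. -/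
open Set

/-- An interval `[a, b]` containing `0` is the range of `t ↦ (t₀ + t) * c` on `[-1, 1]`, for suitable
`t₀ ∈ [-1, 1]` and `c`. -/
theorem exists_midpoint_scale {a b : ℝ} (ha : a ≤ 0) (hb : 0 ≤ b) :
    ∃ t₀ ∈ Icc (-1 : ℝ) 1, ∃ c : ℝ, (t₀ - 1) * c = a ∧ (t₀ + 1) * c = b ∧
      ∀ β ∈ Icc a b, ∃ t ∈ Icc (-1 : ℝ) 1, (t₀ + t) * c = β := by
  rcases (ha.trans hb).eq_or_lt with hab | hab
  · obtain rfl : a = 0 := le_antisymm ha (hab ▸ hb)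
    subst hab
    refine ⟨0, by norm_num, 0, by simp, by simp, fun β hβ => ⟨0, by norm_num, ?_⟩⟩
    simpa using (le_antisymm hβ.2 hβ.1).symm
  · have hd : 0 < b - a := sub_pos.2 hab
    refine ⟨(a + b) / (b - a), ⟨?_, ?_⟩, (b - a) / 2, by field_simp; ring, by field_simp; ring,
      fun β hβ => ⟨(2 * β - (a + b)) / (b - a), ⟨?_, ?_⟩, by field_simp; ring⟩⟩
    · rw [le_div_iff₀ hd]; linarith
    · rw [div_le_iff₀ hd]; linarith
    · rw [le_div_iff₀ hd]; linarith [hβ.1]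
    · rw [div_le_iff₀ hd]; linarith [hβ.2]

/-- Finitely many points of a set of reals containing `0` lie between two points of the set, one
nonpositive and one nonnegative. -/
theorem exists_mem_bounds_of_finite {ι : Type*} [Finite ι] {S : Set ℝ} (h0 : (0 : ℝ) ∈ S)
    {β : ι → ℝ} (hβ : ∀ i, β i ∈ S) :
    ∃ a ∈ S, ∃ b ∈ S, a ≤ 0 ∧ 0 ≤ b ∧ ∀ i, β i ∈ Icc a b := by
  have hfin : (insert 0 (range β)).Finite := (finite_range β).insert 0
  have hsub : insert 0 (range β) ⊆ S := insert_subset h0 (range_subset_iff.2 hβ)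
  obtain ⟨a, ha, hmin⟩ := exists_min_image _ id hfin (insert_nonempty _ _)
  obtain ⟨b, hb, hmax⟩ := exists_max_image _ id hfin (insert_nonempty _ _)
  exact ⟨a, hsub ha, b, hsub hb, hmin 0 (mem_insert _ _), hmax 0 (mem_insert _ _),
    fun i => ⟨hmin _ (mem_insert_of_mem _ (mem_range_self i)),
      hmax _ (mem_insert_of_mem _ (mem_range_self i))⟩⟩

theorem Convex.add_smul_mem_of_mem_Icc {H : Type*} [AddCommGroup H] [Module ℝ H] {V : Set H}
    (hV : Convex ℝ V) {t₀ t : ℝ} {v : H} (h₁ : (t₀ - 1) • v ∈ V) (h₂ : (t₀ + 1) • v ∈ V)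
    (ht : t ∈ Icc (-1 : ℝ) 1) : (t₀ + t) • v ∈ V := by
  have h := hV h₁ h₂ (a := (1 - t) / 2) (b := (1 + t) / 2) (by linarith [ht.2])
    (by linarith [ht.1]) (by ring)
  convert h using 1
  module

theorem stmt10 (H : Type*) [NormedAddCommGroup H] [InnerProductSpace ℝ H]
    (n : ℕ) (hn : 0 < n) (V : Set H) (hV : Convex ℝ V) (h0 : (0 : H) ∈ V)
    (ω : Fin n → H) :
    sInf {r : ℝ | ∃ u : H, r = (1 / n : ℝ) * ∑ i,
        sInf {d : ℝ | ∃ β : ℝ, β • u ∈ V ∧ d = ‖ω i - β • u‖ ^ 2}} =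
    sInf {r : ℝ | ∃ t₀ : ℝ, ∃ v : H, t₀ ∈ Icc (-1 : ℝ) 1 ∧
        (t₀ - 1) • v ∈ V ∧ (t₀ + 1) • v ∈ V ∧
        r = (1 / n : ℝ) * ∑ i,
          sInf {d : ℝ | ∃ t ∈ Icc (-1 : ℝ) 1, d = ‖ω i - (t₀ + t) • v‖ ^ 2}} := by
  have hn' : (0 : ℝ) < n := Nat.cast_pos.2 hn
  apply le_antisymm
  · refine le_csInf ⟨_, 0, 0, by norm_num, by simpa using h0, by simpa using h0, rfl⟩ ?_
    rintro _ ⟨t₀, v, -, h₁, h₂, rfl⟩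
    refine le_trans (csInf_le ⟨0, ?_⟩ ⟨v, rfl⟩) ?_
    · rintro _ ⟨u, rfl⟩
      refine mul_nonneg (by positivity) (Finset.sum_nonneg fun i _ => Real.sInf_nonneg ?_)
      rintro _ ⟨β, -, rfl⟩
      positivity
    · refine mul_le_mul_of_nonneg_left (Finset.sum_le_sum fun i _ => csInf_le_csInf ?_ ?_ ?_)
        (by positivity)
      · refine ⟨0, ?_⟩
        rintro _ ⟨β, -, rfl⟩
        positivity
      · exact ⟨_, 0, by norm_num, rfl⟩
      · rintro _ ⟨t, ht, rfl⟩
        exact ⟨t₀ + t, hV.add_smul_mem_of_mem_Icc h₁ h₂ ht, rfl⟩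
  · refine le_csInf ⟨_, 0, rfl⟩ ?_
    rintro _ ⟨u, rfl⟩
    refine le_of_forall_pos_le_add fun ε hε => ?_
    have happrox (i : Fin n) : ∃ β : ℝ, β • u ∈ V ∧ ‖ω i - β • u‖ ^ 2 <
        sInf {d : ℝ | ∃ β : ℝ, β • u ∈ V ∧ d = ‖ω i - β • u‖ ^ 2} + ε := by
      obtain ⟨_, ⟨β, hβ, rfl⟩, hlt⟩ := exists_lt_of_csInf_lt
        (s := {d : ℝ | ∃ β : ℝ, β • u ∈ V ∧ d = ‖ω i - β • u‖ ^ 2})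
        ⟨_, 0, by simpa using h0, rfl⟩ (lt_add_of_pos_right _ hε)
      exact ⟨β, hβ, hlt⟩
    choose β hβV hβ using happrox
    obtain ⟨a, haV, b, hbV, ha, hb, hab⟩ :=
      exists_mem_bounds_of_finite (S := {x : ℝ | x • u ∈ V}) (by simpa using h0) hβV
    obtain ⟨t₀, ht₀, c, hca, hcb, hc⟩ := exists_midpoint_scale ha hb
    refine le_trans (csInf_le ⟨0, ?_⟩ ⟨t₀, c • u, ht₀, ?_, ?_, rfl⟩) ?_
    · rintro _ ⟨t₀, v, -, -, -, rfl⟩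
      refine mul_nonneg (by positivity) (Finset.sum_nonneg fun i _ => Real.sInf_nonneg ?_)
      rintro _ ⟨t, -, rfl⟩
      positivity
    · rwa [smul_smul, hca]
    · rwa [smul_smul, hcb]
    · calc _ ≤ (1 / n : ℝ) * ∑ i,
            (sInf {d : ℝ | ∃ β : ℝ, β • u ∈ V ∧ d = ‖ω i - β • u‖ ^ 2} + ε) := by
            refine mul_le_mul_of_nonneg_left (Finset.sum_le_sum fun i _ => ?_) (by positivity)
            obtain ⟨t, ht, htβ⟩ := hc _ (hab i)
            refine le_trans (csInf_le ⟨0, ?_⟩ ⟨t, ht, rfl⟩) ?_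
            · rintro _ ⟨t, -, rfl⟩
              positivity
            · rw [smul_smul, htβ]
              exact (hβ i).le
        _ = _ := by
            rw [Finset.sum_add_distrib, mul_add]
            simp [hn'.ne']
end

section
/- Let a < b be reals, let a = x₁ < x₂ < ⋯ < x_N = b be a grid, let t₀ ∈ (−1, 1), and let v ∈ ℝ^N. Then the following two conditions are equivalent. Condition 1: for both ε = −1 and ε = +1, the sequence j ↦ x_j + (t₀ + ε)v_j is nondecreasing and satisfies x_j + (t₀ + ε)v_j ∈ [a, b] for all j. Condition 2: for all j, m_j ≤ v_j ≤ M_j, where m_j = max((a − x_j)/(t₀ + 1), (b − x_j)/(t₀ − 1)) and M_j = min((a − x_j)/(t₀ − 1), (b − x_j)/(t₀ + 1)); and for all 1 ≤ j ≤ N−1, −1/(t₀ + 1) ≤ (v_{j+1} − v_j)/(x_{j+1} − x_j) ≤ 1/(1 − t₀). -/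
open Set

theorem add_mul_mem_Icc_iff_of_pos {a b y c w : ℝ} (hc : 0 < c) :
    y + c * w ∈ Icc a b ↔ (a - y) / c ≤ w ∧ w ≤ (b - y) / c := by
  rw [mem_Icc, div_le_iff₀ hc, le_div_iff₀ hc, sub_le_iff_le_add', le_sub_iff_add_le',
    mul_comm w c]

theorem add_mul_mem_Icc_iff_of_neg {a b y c w : ℝ} (hc : c < 0) :
    y + c * w ∈ Icc a b ↔ (b - y) / c ≤ w ∧ w ≤ (a - y) / c := by
  rw [mem_Icc, div_le_iff_of_neg hc, le_div_iff_of_neg hc, sub_le_iff_le_add',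
    le_sub_iff_add_le', mul_comm w c, and_comm]

theorem add_mul_le_add_mul_iff_of_pos {y z c u w : ℝ} (hc : 0 < c) (hyz : y < z) :
    y + c * u ≤ z + c * w ↔ -1 / c ≤ (w - u) / (z - y) := by
  rw [div_le_div_iff₀ hc (sub_pos.2 hyz)]
  constructor <;> intro h <;> linarith

theorem add_mul_le_add_mul_iff_of_neg {y z c u w : ℝ} (hc : c < 0) (hyz : y < z) :
    y + c * u ≤ z + c * w ↔ (w - u) / (z - y) ≤ 1 / -c := by
  rw [div_le_div_iff₀ (sub_pos.2 hyz) (neg_pos.2 hc)]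
  constructor <;> intro h <;> linarith

theorem stmt13 (N : ℕ) (hN : 2 ≤ N) (a b : ℝ) (hab : a < b)
    (x : ℕ → ℝ) (hxa : x 1 = a) (hxb : x N = b)
    (hmono : ∀ j, 1 ≤ j → j < N → x j < x (j + 1))
    (t₀ : ℝ) (ht₀ : t₀ ∈ Ioo (-1 : ℝ) 1) (v : ℕ → ℝ) :
    -- Condition 1: for ε = ±1, the sequence j ↦ x_j + (t₀+ε)v_j is nondecreasing
    -- with values in [a,b].
    ((∀ ε : ℝ, ε = -1 ∨ ε = 1 →
        (∀ j, 1 ≤ j → j < N →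
          x j + (t₀ + ε) * v j ≤ x (j + 1) + (t₀ + ε) * v (j + 1)) ∧
        (∀ j, 1 ≤ j → j ≤ N → x j + (t₀ + ε) * v j ∈ Icc a b)))
    ↔
    -- Condition 2: box constraint m_j ≤ v_j ≤ M_j and bounds on the discrete derivative.
    ((∀ j, 1 ≤ j → j ≤ N →
        max ((a - x j) / (t₀ + 1)) ((b - x j) / (t₀ - 1)) ≤ v j ∧
        v j ≤ min ((a - x j) / (t₀ - 1)) ((b - x j) / (t₀ + 1))) ∧
      (∀ j, 1 ≤ j → j < N →
        -1 / (t₀ + 1) ≤ (v (j + 1) - v j) / (x (j + 1) - x j) ∧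
        (v (j + 1) - v j) / (x (j + 1) - x j) ≤ 1 / (1 - t₀))) := by
  have hp : 0 < t₀ + 1 := by linarith [ht₀.1]
  have hn : t₀ - 1 < 0 := by linarith [ht₀.2]
  have box (j : ℕ) :
      (max ((a - x j) / (t₀ + 1)) ((b - x j) / (t₀ - 1)) ≤ v j ∧
        v j ≤ min ((a - x j) / (t₀ - 1)) ((b - x j) / (t₀ + 1))) ↔
      x j + (t₀ - 1) * v j ∈ Icc a b ∧ x j + (t₀ + 1) * v j ∈ Icc a b := by
    rw [add_mul_mem_Icc_iff_of_neg hn, add_mul_mem_Icc_iff_of_pos hp, max_le_iff, le_min_iff]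
    tauto
  have slope (j : ℕ) (h1 : 1 ≤ j) (h2 : j < N) :
      (-1 / (t₀ + 1) ≤ (v (j + 1) - v j) / (x (j + 1) - x j) ∧
        (v (j + 1) - v j) / (x (j + 1) - x j) ≤ 1 / (1 - t₀)) ↔
      x j + (t₀ + 1) * v j ≤ x (j + 1) + (t₀ + 1) * v (j + 1) ∧
        x j + (t₀ - 1) * v j ≤ x (j + 1) + (t₀ - 1) * v (j + 1) := by
    rw [add_mul_le_add_mul_iff_of_pos hp (hmono j h1 h2),
      add_mul_le_add_mul_iff_of_neg hn (hmono j h1 h2), neg_sub]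
  simp only [forall_eq_or_imp, forall_eq, ← sub_eq_add_neg, box]
  constructor
  · rintro ⟨⟨hm, hm'⟩, hp, hp'⟩
    exact ⟨fun j h1 h2 => ⟨hm' j h1 h2, hp' j h1 h2⟩,
      fun j h1 h2 => (slope j h1 h2).2 ⟨hp j h1 h2, hm j h1 h2⟩⟩
  · rintro ⟨hbox, hslope⟩
    exact ⟨⟨fun j h1 h2 => ((slope j h1 h2).1 (hslope j h1 h2)).2,
        fun j h1 h2 => (hbox j h1 h2).1⟩,
      fun j h1 h2 => ((slope j h1 h2).1 (hslope j h1 h2)).1,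
      fun j h1 h2 => (hbox j h1 h2).2⟩
end

section
/- Let a < b, α = b − a, N and n be positive integers, t₀ ∈ (−1, 1), and let f₁, …, f_N ≥ 0 and numbers w_i^j (1 ≤ i ≤ n, 1 ≤ j ≤ N) be given. Set f_∞ = max_j f_j, w_∞ = max_{i,j} |w_i^j| and γ = 2(1 + |t₀|)α + w_∞. Define F : ℝ^N × ℝ^n → ℝ by F(v, t) = Σ_{i=1}^n Σ_{j=1}^N f_j (w_i^j − (t₀ + t_i) v_j)². Then the gradient of F is Lipschitz on the set {(v, t) : |v_j| ≤ α for all j, |t_i| ≤ 1 for all i} with Lipschitz constant M = 2 f_∞ · max{ N(α² + γ), n((1 + |t₀|)² + γ) }: for all (v, t), (v′, t′) in this set, ‖∇F(v, t) − ∇F(v′, t′)‖ ≤ M ‖(v, t) − (v′, t′)‖, where ‖·‖ is the Euclidean norm on ℝ^{N+n}. -/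
open Set

theorem sum_sq_mulVec_le_of_abs_row_sum_le {ι : Type*} [Fintype ι] (K : Matrix ι ι ℝ)
    (hK : K.IsSymm) {M : ℝ} (hM : 0 ≤ M) (hrow : ∀ k, ∑ l, |K k l| ≤ M) (x : ι → ℝ) :
    ∑ k, (K.mulVec x k) ^ 2 ≤ M ^ 2 * ∑ l, x l ^ 2 := by
  calc ∑ k, (K.mulVec x k) ^ 2
      ≤ ∑ k, M * ∑ l, |K k l| * x l ^ 2 := by
        refine Finset.sum_le_sum fun k _ => ?_
        refine (Finset.sum_sq_le_sum_mul_sum_of_sq_le_mul Finset.univ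
          (f := fun l => |K k l|) (g := fun l => |K k l| * x l ^ 2)
          (fun l _ => by positivity) (fun l _ => by positivity) (fun l _ => ?_)).trans ?_
        · rw [← mul_assoc, abs_mul_abs_self, mul_pow, sq (K k l)]
        · exact mul_le_mul_of_nonneg_right (hrow k)
            (Finset.sum_nonneg fun l _ => by positivity)
    _ = M * ∑ l, (∑ k, |K l k|) * x l ^ 2 := by
        rw [← Finset.mul_sum, Finset.sum_comm]
        simp only [Finset.sum_mul]
        congr 1
        refine Finset.sum_congr rfl fun l _ => Finset.sum_congr rfl fun k _ => ?_
        rw [hK.apply]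
    _ ≤ M * ∑ l, M * x l ^ 2 := by
        gcongr with l
        exact hrow l
    _ = M ^ 2 * ∑ l, x l ^ 2 := by
        rw [← Finset.mul_sum]; ring

theorem norm_le_of_eq_mulVec {ι : Type*} [Fintype ι] (K : Matrix ι ι ℝ)
    (hK : K.IsSymm) {M : ℝ} (hM : 0 ≤ M) (hrow : ∀ k, ∑ l, |K k l| ≤ M)
    (x y : EuclideanSpace ℝ ι) (h : ∀ k, y k = K.mulVec x k) : ‖y‖ ≤ M * ‖x‖ := by
  refine (sq_le_sq₀ (norm_nonneg _) (by positivity)).1 ?_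
  rw [mul_pow, EuclideanSpace.real_norm_sq_eq, EuclideanSpace.real_norm_sq_eq]
  simp only [h]
  exact sum_sq_mulVec_le_of_abs_row_sum_le K hK hM hrow x

theorem gradient_apply_eq_fderiv_single {ι : Type*} [Fintype ι] [DecidableEq ι]
    (F : EuclideanSpace ℝ ι → ℝ) (p : EuclideanSpace ℝ ι) (k : ι) :
    gradient F p k = fderiv ℝ F p (EuclideanSpace.single k 1) := by
  have h := EuclideanSpace.inner_single_right k (1 : ℝ) (gradient F p)
  rw [gradient, InnerProductSpace.toDual_symm_apply] at h
  simpa [gradient] using h.symm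

theorem fderiv_sum_mul_sub_mul_sq {N n : ℕ} (t₀ : ℝ) (f : Fin N → ℝ) (w : Fin n → Fin N → ℝ)
    (p d : EuclideanSpace ℝ (Fin N ⊕ Fin n)) :
    fderiv ℝ (fun p : EuclideanSpace ℝ (Fin N ⊕ Fin n) => ∑ i : Fin n, ∑ j : Fin N,
        f j * (w i j - (t₀ + p (Sum.inr i)) * p (Sum.inl j)) ^ 2) p d =
      ∑ i : Fin n, ∑ j : Fin N, -2 * f j *
        (w i j - (t₀ + p (Sum.inr i)) * p (Sum.inl j)) *
        (d (Sum.inr i) * p (Sum.inl j) + (t₀ + p (Sum.inr i)) * d (Sum.inl j)) := by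
  have hc : ∀ k, HasFDerivAt (fun p : EuclideanSpace ℝ (Fin N ⊕ Fin n) => p k)
      (EuclideanSpace.proj k : EuclideanSpace ℝ (Fin N ⊕ Fin n) →L[ℝ] ℝ) p :=
    fun k => (EuclideanSpace.proj k : EuclideanSpace ℝ (Fin N ⊕ Fin n) →L[ℝ] ℝ).hasFDerivAt
  have h := HasFDerivAt.fun_sum (u := Finset.univ) fun (i : Fin n) _ =>
    HasFDerivAt.fun_sum (u := Finset.univ) fun (j : Fin N) _ =>
      (((((hc (Sum.inr i)).const_add t₀).mul (hc (Sum.inl j))).const_sub (w i j)).pow 2).const_mul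
        (f j)
  have h' := congrArg (fun L => L d) h.fderiv
  refine h'.trans ?_
  simp only [sum_apply]
  refine Finset.sum_congr rfl fun i _ => Finset.sum_congr rfl fun j _ => ?_
  simp
  ring


theorem stmt14 (N n : ℕ) (hN : 0 < N) (hn : 0 < n)
    (a b : ℝ) (hab : a < b) (α : ℝ) (hα : α = b - a)
    (t₀ : ℝ) (ht₀ : t₀ ∈ Ioo (-1 : ℝ) 1)
    (f : Fin N → ℝ) (hf : ∀ j, 0 ≤ f j) (w : Fin n → Fin N → ℝ)
    (finf : ℝ) (hf1 : ∀ j, f j ≤ finf) (hf2 : ∃ j, f j = finf)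
    (winf : ℝ) (hw1 : ∀ i j, |w i j| ≤ winf) (hw2 : ∃ i j, |w i j| = winf)
    (γ : ℝ) (hγ : γ = 2 * (1 + |t₀|) * α + winf)
    (M : ℝ)
    (hM : M = 2 * finf * max ((N : ℝ) * (α ^ 2 + γ)) ((n : ℝ) * ((1 + |t₀|) ^ 2 + γ)))
    (F : EuclideanSpace ℝ (Fin N ⊕ Fin n) → ℝ)
    (hF : ∀ p, F p =
      ∑ i : Fin n, ∑ j : Fin N,
        f j * (w i j - (t₀ + p (Sum.inr i)) * p (Sum.inl j)) ^ 2) :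
    ∀ p q : EuclideanSpace ℝ (Fin N ⊕ Fin n),
      (∀ j, |p (Sum.inl j)| ≤ α) → (∀ i, |p (Sum.inr i)| ≤ 1) →
      (∀ j, |q (Sum.inl j)| ≤ α) → (∀ i, |q (Sum.inr i)| ≤ 1) →
      ‖gradient F p - gradient F q‖ ≤ M * ‖p - q‖ := by
  intro p q hpv hpt hqv hqt
  obtain ⟨j₀, hj₀⟩ := hf2
  obtain ⟨i₁, j₁, hw₁⟩ := hw2
  have hfinf : 0 ≤ finf := hj₀ ▸ hf j₀
  have hwinf : 0 ≤ winf := hw₁ ▸ abs_nonneg _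
  have hα0 : 0 ≤ α := by linarith
  set S := 1 + |t₀| with hS
  have hS0 : 0 ≤ S := by positivity
  have hγ0 : 0 ≤ γ := by rw [hγ]; positivity
  have hM0 : 0 ≤ M := by
    rw [hM]
    exact mul_nonneg (by positivity) (le_max_of_le_left (by positivity))
  have hs : ∀ x : ℝ, |x| ≤ 1 → |t₀ + x| ≤ S := fun x hx =>
    (abs_add_le _ _).trans (by linarith)
  have hmid : ∀ {x y c : ℝ}, |x| ≤ c → |y| ≤ c → |(x ^ 2 + y ^ 2) / 2| ≤ c ^ 2 := by
    intro x y c hx hy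
    rw [abs_of_nonneg (by positivity)]
    have := sq_le_sq' (abs_le.1 hx).1 (abs_le.1 hx).2
    have := sq_le_sq' (abs_le.1 hy).1 (abs_le.1 hy).2
    linarith
  let s : Fin n → ℝ := fun i => t₀ + p (Sum.inr i)
  let s' : Fin n → ℝ := fun i => t₀ + q (Sum.inr i)
  let v : Fin N → ℝ := fun j => p (Sum.inl j)
  let v' : Fin N → ℝ := fun j => q (Sum.inl j)
  let A : Fin N → ℝ := fun j => ∑ i, 2 * f j * ((s i ^ 2 + s' i ^ 2) / 2)
  let C : Fin n → ℝ := fun i => ∑ j, 2 * f j * ((v j ^ 2 + v' j ^ 2) / 2)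
  let B : Matrix (Fin N) (Fin n) ℝ := fun j i =>
    2 * f j * ((s i + s' i) * (v j + v' j) / 2 - w i j)
  have hB : ∀ j i, |B j i| ≤ 2 * finf * γ := by
    intro j i
    have h1 : |s i + s' i| ≤ 2 * S :=
      (abs_add_le _ _).trans (by linarith [hs _ (hpt i), hs _ (hqt i)])
    have h2 : |v j + v' j| ≤ 2 * α :=
      (abs_add_le _ _).trans (by linarith [hpv j, hqv j])
    have h3 : |(s i + s' i) * (v j + v' j) / 2 - w i j| ≤ γ := by
      refine (abs_sub _ _).trans ?_
      rw [abs_div, abs_mul, abs_two, hγ]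
      have := mul_le_mul h1 h2 (abs_nonneg _) (by positivity)
      linarith [hw1 i j]
    simp only [B]
    rw [abs_mul, abs_of_nonneg (mul_nonneg zero_le_two (hf j))]
    exact mul_le_mul (by linarith [hf1 j]) h3 (abs_nonneg _) (by positivity)
  have hA : ∀ j, |A j| ≤ n * (2 * finf * S ^ 2) := by
    intro j
    refine (Finset.abs_sum_le_sum_abs _ _).trans ?_
    refine (Finset.sum_le_card_nsmul _ _ (2 * finf * S ^ 2) fun i _ => ?_).trans (by simp)
    rw [abs_mul, abs_of_nonneg (mul_nonneg zero_le_two (hf j))]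
    exact mul_le_mul (by linarith [hf1 j]) (hmid (hs _ (hpt i)) (hs _ (hqt i)))
      (abs_nonneg _) (by positivity)
  have hC : ∀ i, |C i| ≤ N * (2 * finf * α ^ 2) := by
    intro i
    refine (Finset.abs_sum_le_sum_abs _ _).trans ?_
    refine (Finset.sum_le_card_nsmul _ _ (2 * finf * α ^ 2) fun j _ => ?_).trans (by simp)
    rw [abs_mul, abs_of_nonneg (mul_nonneg zero_le_two (hf j))]
    exact mul_le_mul (by linarith [hf1 j]) (hmid (hpv j) (hqv j)) (abs_nonneg _) (by positivity)
  have habs : ∀ {m : ℕ} (c : Fin m → ℝ) (k : Fin m),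
      ∑ l, |Matrix.diagonal c k l| = |c k| := by
    intro m c k
    rw [Finset.sum_eq_single k (fun l _ hl => by simp [Matrix.diagonal_apply_ne _ hl.symm])
      (by simp)]
    simp
  refine norm_le_of_eq_mulVec
    (Matrix.fromBlocks (Matrix.diagonal A) B B.transpose (Matrix.diagonal C)) ?_ hM0 ?_ _ _ ?_
  · exact Matrix.IsSymm.fromBlocks (Matrix.isSymm_diagonal A) rfl (Matrix.isSymm_diagonal C)
  · rintro (j | i)
    · simp only [Fintype.sum_sum_type, Matrix.fromBlocks_apply₁₁, Matrix.fromBlocks_apply₁₂, habs]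
      have h1 : ∑ i, |B j i| ≤ n * (2 * finf * γ) :=
        (Finset.sum_le_card_nsmul _ _ _ fun i _ => hB j i).trans (by simp)
      calc |A j| + ∑ i, |B j i| ≤ 2 * finf * (n * (S ^ 2 + γ)) := by linarith [hA j]
        _ ≤ M := by rw [hM]; gcongr; exact le_max_right _ _
    · simp only [Fintype.sum_sum_type, Matrix.fromBlocks_apply₂₁, Matrix.fromBlocks_apply₂₂, habs,
        Matrix.transpose_apply]
      have h1 : ∑ j, |B j i| ≤ N * (2 * finf * γ) :=
        (Finset.sum_le_card_nsmul _ _ _ fun j _ => hB j i).trans (by simp)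
      calc ∑ j, |B j i| + |C i| ≤ 2 * finf * (N * (α ^ 2 + γ)) := by linarith [hC i]
        _ ≤ M := by rw [hM]; gcongr; exact le_max_left _ _
  · have hF' := funext hF
    intro k
    rw [PiLp.sub_apply, gradient_apply_eq_fderiv_single, gradient_apply_eq_fderiv_single, hF',
      fderiv_sum_mul_sub_mul_sq, fderiv_sum_mul_sub_mul_sq]
    rcases k with j | i
    · simp only [Matrix.mulVec, dotProduct, Fintype.sum_sum_type, Matrix.fromBlocks_apply₁₁,
        Matrix.fromBlocks_apply₁₂, Matrix.diagonal_apply, ite_mul, zero_mul, Finset.sum_ite_eq,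
        Finset.mem_univ, if_true, PiLp.single_apply, reduceCtorEq, if_false, zero_add,
        Sum.inl.injEq, mul_ite, mul_one, mul_zero, PiLp.sub_apply,
        Finset.sum_ite_eq']
      simp only [A, B, Finset.sum_mul, ← Finset.sum_add_distrib, ← Finset.sum_sub_distrib]
      refine Finset.sum_congr rfl fun i _ => ?_
      simp only [s, s', v, v']
      ring
    · rw [Finset.sum_comm, Finset.sum_comm 
        (f := fun i' j => -2 * f j * (w i' j - (t₀ + q (Sum.inr i')) * _) * _)]
      simp only [Matrix.mulVec, dotProduct, Fintype.sum_sum_type, Matrix.fromBlocks_apply₂₁,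
        Matrix.fromBlocks_apply₂₂, Matrix.diagonal_apply, ite_mul, zero_mul, Finset.sum_ite_eq,
        Finset.mem_univ, if_true, PiLp.single_apply, reduceCtorEq, if_false, add_zero,
        Sum.inr.injEq, mul_ite, one_mul, mul_zero, PiLp.sub_apply,
        Finset.sum_ite_eq', Matrix.transpose_apply]
      simp only [C, B, Finset.sum_mul, ← Finset.sum_add_distrib, ← Finset.sum_sub_distrib]
      refine Finset.sum_congr rfl fun j _ => ?_
      simp only [s, s', v, v']
      ring
end
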